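/- [Covering claim for tops with large F-intersection] There exist absolute constants C, c > 0 such that the following holds for every w > 0, every ε ∈ (0,1), every σ ∈ (0,1], every integer j ≥ 0, every measurable F ⊆ ℝ², and every tile R. Let 𝒯 be a finite collection of trees satisfying: (i) top(T) ≤ R for every T ∈ 𝒯; (ii) the tops {top(T) : T ∈ 𝒯} are pairwise disjoint sets; (iii) |σ^{−ε}·top(T) ∩ F| ≥ σ^{1+ε}·|σ^{−ε}·top(T)| for every T ∈ 𝒯; and (iv) Σ_{T∈𝒯}|top(T)| ≥ 2^{−j}·|R|. Then |F ∩ C·σ^{−ε}·R| ≥ c·σ^{1+ε}·2^{−j}·|R|, where C·σ^{−ε}·R is the dilate of R by the factor C·σ^{−ε} about its center. -/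

import Mathlib

open MeasureTheory Set Filter
open scoped Classical

noncomputable section

namespace Bateman

/-- A tile: frequency scale `l` (the frequency interval has length `2^{-l}`), frequency
position `m` (the interval is `[m·2^{-l}, (m+1)·2^{-l})`, contained in `[-2,2]`),
spatial dyadic position `n` (the `x`-projection is `[n·w·2^l, (n+1)·w·2^l)`) and
vertical position `k`. -/
structure Tile where
  l : ℕ
  m : ℤ
  n : ℤ
  k : ℤ
  hlo : (-2 : ℝ) ≤ (m : ℝ) * (2:ℝ) ^ (-(l:ℤ))
  hhi : ((m : ℝ) + 1) * (2:ℝ) ^ (-(l:ℤ)) ≤ 2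

noncomputable instance : DecidableEq Tile := Classical.decEq _

namespace Tile

/-- Length of the frequency interval of a tile. -/
def freqLen (s : Tile) : ℝ := (2:ℝ) ^ (-(s.l:ℤ))

/-- Frequency interval `ω_s`. -/
def ω (s : Tile) : Set ℝ := Ico ((s.m : ℝ) * s.freqLen) (((s.m : ℝ) + 1) * s.freqLen)

/-- Center of `ω_s`; this is the slope of the long side of the tile. -/
def slope (s : Tile) : ℝ := ((s.m : ℝ) + 1/2) * s.freqLen

/-- Right half `ω_{s,1}` of `ω_s`. -/
def ω1 (s : Tile) : Set ℝ := Ico s.slope (((s.m : ℝ) + 1) * s.freqLen)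

/-- Left half `ω_{s,2}` of `ω_s`. -/
def ω2 (s : Tile) : Set ℝ := Ico ((s.m : ℝ) * s.freqLen) s.slope

/-- Length `L(s) = w·2^l` of the tile. -/
def len (w : ℝ) (s : Tile) : ℝ := w * 2 ^ s.l

/-- The spatial parallelogram of the tile: two vertical sides of length `w`, two long
sides of slope `c(ω_s)` and length `w·2^l`, `x`-projection a dyadic interval. -/
def rect (w : ℝ) (s : Tile) : Set (ℝ × ℝ) :=
  {p | p.1 ∈ Ico ((s.n : ℝ) * s.len w) (((s.n : ℝ) + 1) * s.len w) ∧
       p.2 - s.slope * p.1 ∈ Ico ((s.k : ℝ) * w) (((s.k : ℝ) + 1) * w)}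

/-- Area `|s| = w²·2^l` of the tile. -/
def area (w : ℝ) (s : Tile) : ℝ := w ^ 2 * 2 ^ s.l

/-- Center of the tile. -/
def center (w : ℝ) (s : Tile) : ℝ × ℝ :=
  (((s.n : ℝ) + 1/2) * s.len w,
   s.slope * (((s.n : ℝ) + 1/2) * s.len w) + ((s.k : ℝ) + 1/2) * w)

/-- Dilate `C·s` of the tile by a factor `C` about its center. -/
def dilate (w C : ℝ) (s : Tile) : Set (ℝ × ℝ) :=
  (fun p => s.center w + C • (p - s.center w)) '' s.rect w

/-- Order on tiles: `s ≤ s'` iff `s ⊆ 10·s'` and `ω_{s'} ⊆ ω_s`. -/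
def le (w : ℝ) (s s' : Tile) : Prop := s.rect w ⊆ s'.dilate w 10 ∧ s'.ω ⊆ s.ω

/-- The affine map taking the tile onto the unit square centered at the origin. -/
def unitMap (w : ℝ) (s : Tile) (p : ℝ × ℝ) : ℝ × ℝ :=
  ((p.1 - ((s.n : ℝ) + 1/2) * s.len w) / s.len w,
   (p.2 - s.slope * p.1 - ((s.k : ℝ) + 1/2) * w) / w)

end Tile

/-- The weight `χ(x) = (1 + |x|^{100})⁻¹` on `ℝ²`. -/
def chi (p : ℝ × ℝ) : ℝ := (1 + (p.1 ^ 2 + p.2 ^ 2) ^ (50:ℕ))⁻¹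

/-- `χ_s^{(1)} = |s|⁻¹·χ∘A_s`, the `L¹`-normalized version of `χ` adapted to the tile. -/
def chi1 (w : ℝ) (s : Tile) (p : ℝ × ℝ) : ℝ := (s.area w)⁻¹ * chi (s.unitMap w p)

/-- The density `dense(s) = ∫_{E_s} χ_s^{(1)}` where `E_s = {(x,y) ∈ E : u(x) ∈ ω_s}`. -/
def dens (w : ℝ) (u : ℝ → ℝ) (E : Set (ℝ × ℝ)) (s : Tile) : ℝ :=
  ∫ p in {p ∈ E | u p.1 ∈ s.ω}, chi1 w s p

/-- The upward density `udense(s) = sup{dense(s') : s ≤ s'}`. -/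
def udens (w : ℝ) (u : ℝ → ℝ) (E : Set (ℝ × ℝ)) (s : Tile) : ℝ :=
  sSup {x | ∃ s' : Tile, Tile.le w s s' ∧ x = dens w u E s'}

/-- `e(t) = exp(2πit)`. -/
def e (t : ℝ) : ℂ := Complex.exp (Complex.I * ((2 * Real.pi * t : ℝ) : ℂ))

/-- The multiplier `m̂_ω(ξ,η) = β̃(wη)·β_ω(ξ/η)` of a tile, where
`β_ω(x) = β(2^{l+c}(x − c(ω₁)))` and `c(ω₁) = (m + 3/4)·2^{-l}` is the center of the
right half of `ω`. -/
def mhat (β βt : ℝ → ℝ) (cc : ℕ) (w : ℝ) (s : Tile) (ξ : ℝ × ℝ) : ℝ :=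
  βt (w * ξ.2) * β ((2:ℝ) ^ (s.l + cc) * (ξ.1 / ξ.2 - ((s.m : ℝ) + 3/4) * s.freqLen))

/-- `φ_ω`, the inverse Fourier transform of `(m̂_ω)^{1/2}`. -/
def φω (β βt : ℝ → ℝ) (cc : ℕ) (w : ℝ) (s : Tile) (x : ℝ × ℝ) : ℂ :=
  ∫ ξ : ℝ × ℝ, e (x.1 * ξ.1 + x.2 * ξ.2) * ((Real.sqrt (mhat β βt cc w s ξ) : ℝ) : ℂ)

/-- The `L²`-normalized wave packet `φ_s(p) = |s|^{1/2}·φ_ω(p − c(s))`. -/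
def wp (β βt : ℝ → ℝ) (cc : ℕ) (w : ℝ) (s : Tile) (p : ℝ × ℝ) : ℂ :=
  ((Real.sqrt (s.area w) : ℝ) : ℂ) * φω β βt cc w s (p - s.center w)

/-- `⟨f,g⟩ = ∫ f·conj g`. -/
def inn (f g : ℝ × ℝ → ℂ) : ℂ := ∫ p : ℝ × ℝ, f p * (starRingEnd ℂ) (g p)

/-- The inverse Fourier transform of `ψ_s(θ) = ψ(L(s)·θ)`. -/
def psiCheck (ψ : ℝ → ℝ) (w : ℝ) (s : Tile) (t : ℝ) : ℂ :=
  ∫ θ : ℝ, e (t * θ) * ((ψ (s.len w * θ) : ℝ) : ℂ)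

/-- The transformed wave packet
`phi_s(x₁,x₂) = ∫ ψ̌_s(t)·φ_s(x₁ − t, x₂ − t·u(x₁)) dt`. -/
def phiT (β βt ψ : ℝ → ℝ) (cc : ℕ) (w : ℝ) (u : ℝ → ℝ) (s : Tile) (x : ℝ × ℝ) : ℂ :=
  ∫ t : ℝ, psiCheck ψ w s t * wp β βt cc w s (x.1 - t, x.2 - t * u x.1)

/-- Hypotheses on the bump function `β`: smooth, `[0,1]`-valued, `1` on `[-1,1]`,
vanishing outside `[-2,2]`, with smooth square root. -/
def IsBumpβ (β : ℝ → ℝ) : Prop :=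
  ContDiff ℝ (⊤ : ℕ∞) β ∧ (∀ x, β x ∈ Icc (0:ℝ) 1) ∧ (∀ x ∈ Icc (-1:ℝ) 1, β x = 1) ∧
  (∀ x : ℝ, 2 ≤ |x| → β x = 0) ∧ ContDiff ℝ (⊤ : ℕ∞) (fun x => Real.sqrt (β x))

/-- Hypotheses on the bump function `β̃`: smooth, `[0,1]`-valued, supported in
`[1/2,5/2]` and equal to `1` on `[1,2]`. -/
def IsBumpβt (βt : ℝ → ℝ) : Prop :=
  ContDiff ℝ (⊤ : ℕ∞) βt ∧ (∀ x, βt x ∈ Icc (0:ℝ) 1) ∧ (∀ x ∈ Icc (1:ℝ) 2, βt x = 1) ∧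
  (∀ x : ℝ, x ∉ Icc (1/2 : ℝ) (5/2) → βt x = 0)

/-- Hypotheses on the bump function `ψ`: smooth, `[0,1]`-valued, supported in
`[98/100, 102/100]` and equal to `1` on `[99/100, 101/100]`. -/
def IsBumpψ (ψ : ℝ → ℝ) : Prop :=
  ContDiff ℝ (⊤ : ℕ∞) ψ ∧ (∀ x, ψ x ∈ Icc (0:ℝ) 1) ∧
  (∀ x ∈ Icc (99/100 : ℝ) (101/100), ψ x = 1) ∧
  (∀ x : ℝ, x ∉ Icc (98/100 : ℝ) (102/100) → ψ x = 0)

/-- A tree: a finite set of tiles together with a top tile. -/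
structure Tree where
  tiles : Finset Tile
  top : Tile

/-- `T` is a tree: every tile of `T` lies below the top. -/
def Tree.IsTree (w : ℝ) (T : Tree) : Prop := ∀ s ∈ T.tiles, Tile.le w s T.top

/-- `T` is a `1`-tree: moreover `ω_{top(T)} ∩ ω_{s,1} = ∅` for all `s ∈ T`. -/
def Tree.IsOneTree (w : ℝ) (T : Tree) : Prop :=
  T.IsTree w ∧ ∀ s ∈ T.tiles, T.top.ω ∩ s.ω1 = ∅

/-- The maximal `1`-subtree `T₁` of a tree `T`. -/
def Tree.oneTiles (T : Tree) : Finset Tile :=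
  T.tiles.filter fun s => T.top.ω ∩ s.ω1 = ∅

/-- `(1/|top(T)|)·Σ_{s∈T}|⟨f,φ_s⟩|²`. -/
def energy (β βt : ℝ → ℝ) (cc : ℕ) (w : ℝ) (f : ℝ × ℝ → ℂ) (T : Tree) : ℝ :=
  (T.top.area w)⁻¹ * ∑ s ∈ T.tiles, ‖inn f (wp β βt cc w s)‖ ^ 2

/-- The size of a finite collection of tiles with respect to the set `F`:
the supremum over `1`-trees `T ⊆ S` of `(|top(T)|⁻¹·Σ_{s∈T}|⟨1_F,φ_s⟩|²)^{1/2}`. -/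
def size (β βt : ℝ → ℝ) (cc : ℕ) (w : ℝ) (F : Set (ℝ × ℝ)) (S : Finset Tile) : ℝ :=
  sSup (insert 0 {x | ∃ T : Tree, T.IsOneTree w ∧ T.tiles ⊆ S ∧
    x = Real.sqrt (energy β βt cc w (F.indicator fun _ => (1:ℂ)) T)})

/-- The parallelogram with vertical sides and slope `a`, centered at `c`, with horizontal
half-width `h` and vertical half-height `v`. -/
def slantedBox (a : ℝ) (c : ℝ × ℝ) (h v : ℝ) : Set (ℝ × ℝ) :=
  {p | p.1 ∈ Ico (c.1 - h) (c.1 + h) ∧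
    p.2 - a * p.1 ∈ Ico (c.2 - a * c.1 - v) (c.2 - a * c.1 + v)}

lemma measurableSet_slantedBox (a : ℝ) (c : ℝ × ℝ) (h v : ℝ) :
    MeasurableSet (slantedBox a c h v) := by
  have h₁ : Measurable fun p : ℝ × ℝ => p.1 := measurable_fst
  have h₂ : Measurable fun p : ℝ × ℝ => p.2 - a * p.1 := by fun_prop
  exact (h₁ measurableSet_Ico).inter (h₂ measurableSet_Ico)

lemma volume_slantedBox (a : ℝ) (c : ℝ × ℝ) (h v : ℝ) :
    volume (slantedBox a c h v) = ENNReal.ofReal (2 * h) * ENNReal.ofReal (2 * v) := by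
  rw [Measure.volume_eq_prod, Measure.prod_apply (measurableSet_slantedBox a c h v)]
  have key : ∀ x : ℝ, volume (Prod.mk x ⁻¹' slantedBox a c h v) =
      (Ico (c.1 - h) (c.1 + h)).indicator (fun _ => ENNReal.ofReal (2 * v)) x := by
    intro x
    by_cases hx : x ∈ Ico (c.1 - h) (c.1 + h)
    · have : Prod.mk x ⁻¹' slantedBox a c h v =
          Ico (c.2 - a * c.1 - v + a * x) (c.2 - a * c.1 + v + a * x) := by
        ext y
        simp only [slantedBox, mem_preimage, mem_ofPred_eq, hx, true_and]
        simp only [mem_Ico]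
        constructor <;> rintro ⟨h₁, h₂⟩ <;> constructor <;> linarith
      rw [this, indicator_of_mem hx, Real.volume_Ico]
      congr 1
      ring
    · have : Prod.mk x ⁻¹' slantedBox a c h v = ∅ := by
        ext y
        simp only [slantedBox, mem_preimage, mem_ofPred_eq, hx, false_and, mem_empty_iff_false]
      rw [this, indicator_of_notMem hx, measure_empty]
  simp_rw [key]
  rw [lintegral_indicator measurableSet_Ico, setLIntegral_const, Real.volume_Ico, mul_comm]
  congr 2
  ring

lemma volume_slantedBox_ne_top (a : ℝ) (c : ℝ × ℝ) (h v : ℝ) :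
    volume (slantedBox a c h v) ≠ ⊤ := by
  rw [volume_slantedBox]
  exact ENNReal.mul_ne_top ENNReal.ofReal_ne_top ENNReal.ofReal_ne_top

lemma measureReal_slantedBox (a : ℝ) (c : ℝ × ℝ) {h v : ℝ} (hh : 0 ≤ h) (hv : 0 ≤ v) :
    volume.real (slantedBox a c h v) = 4 * h * v := by
  rw [measureReal_def, volume_slantedBox, ENNReal.toReal_mul,
    ENNReal.toReal_ofReal (by positivity), ENNReal.toReal_ofReal (by positivity)]
  ring

namespace Tile

lemma freqLen_pos (s : Tile) : 0 < s.freqLen := by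
  unfold freqLen
  positivity

lemma len_pos {w : ℝ} (hw : 0 < w) (s : Tile) : 0 < s.len w := by
  unfold len
  positivity

lemma len_mul_freqLen (w : ℝ) (s : Tile) : s.len w * s.freqLen = w := by
  unfold len freqLen
  rw [zpow_neg, zpow_natCast, mul_assoc, mul_inv_cancel₀ (by positivity), mul_one]

lemma area_eq (w : ℝ) (s : Tile) : s.area w = s.len w * w := by
  unfold area len
  ring

lemma rect_eq_slantedBox (w : ℝ) (s : Tile) :
    s.rect w = slantedBox s.slope (s.center w) (s.len w / 2) (w / 2) := by
  ext p
  simp only [rect, slantedBox, center, mem_ofPred_eq, mem_Ico]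
  constructor <;> rintro ⟨⟨h₁, h₂⟩, h₃, h₄⟩ <;> refine ⟨⟨?_, ?_⟩, ?_, ?_⟩ <;> linarith

lemma dilate_eq_slantedBox (w : ℝ) {C : ℝ} (hC : 0 < C) (s : Tile) :
    s.dilate w C =
      slantedBox s.slope (s.center w) (C * (s.len w / 2)) (C * (w / 2)) := by
  rw [dilate, rect_eq_slantedBox]
  set c := s.center w
  ext p
  simp only [slantedBox, mem_image, mem_ofPred_eq, mem_Ico]
  constructor
  · rintro ⟨q, ⟨⟨h₁, h₂⟩, h₃, h₄⟩, rfl⟩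
    simp only [Prod.fst_add, Prod.snd_add, Prod.smul_fst, Prod.smul_snd, Prod.fst_sub,
      Prod.snd_sub, smul_eq_mul]
    refine ⟨⟨?_, ?_⟩, ?_, ?_⟩ <;> nlinarith
  · rintro ⟨⟨h₁, h₂⟩, h₃, h₄⟩
    have hx : C * (C⁻¹ * (p.1 - c.1)) = p.1 - c.1 := mul_inv_cancel_left₀ hC.ne' _
    have hy : C * (C⁻¹ * (p.2 - c.2)) = p.2 - c.2 := mul_inv_cancel_left₀ hC.ne' _
    refine ⟨c + C⁻¹ • (p - c), ?_, ?_⟩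
    · simp only [Prod.fst_add, Prod.snd_add, Prod.smul_fst, Prod.smul_snd, Prod.fst_sub,
        Prod.snd_sub, smul_eq_mul]
      generalize C⁻¹ * (p.1 - c.1) = x at hx ⊢
      generalize C⁻¹ * (p.2 - c.2) = y at hy ⊢
      have hz : C * (y - s.slope * x) = (p.2 - s.slope * p.1) - (c.2 - s.slope * c.1) := by
        rw [mul_sub, hy, mul_left_comm, hx]
        ring
      have x₁ : -(s.len w / 2) ≤ x := le_of_mul_le_mul_left (by linarith) hC
      have x₂ : x < s.len w / 2 := lt_of_mul_lt_mul_left (by linarith) hC.le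
      have y₁ : -(w / 2) ≤ y - s.slope * x := le_of_mul_le_mul_left (by linarith) hC
      have y₂ : y - s.slope * x < w / 2 := lt_of_mul_lt_mul_left (by linarith) hC.le
      refine ⟨⟨?_, ?_⟩, ?_, ?_⟩ <;> linarith
    · ext <;> simp [hC.ne']

lemma center_mem_rect {w : ℝ} (hw : 0 < w) (s : Tile) : s.center w ∈ s.rect w := by
  have := len_pos hw s
  rw [rect_eq_slantedBox]
  refine ⟨⟨?_, ?_⟩, ?_, ?_⟩ <;> linarith

lemma measureReal_rect {w : ℝ} (hw : 0 < w) (s : Tile) :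
    volume.real (s.rect w) = s.area w := by
  have := len_pos hw s
  rw [rect_eq_slantedBox, measureReal_slantedBox _ _ (by positivity) (by positivity), area_eq]
  ring

lemma measureReal_dilate {w C : ℝ} (hw : 0 < w) (hC : 0 < C) (s : Tile) :
    volume.real (s.dilate w C) = C ^ 2 * s.area w := by
  have := len_pos hw s
  rw [dilate_eq_slantedBox w hC, measureReal_slantedBox _ _ (by positivity) (by positivity),
    area_eq]
  ring

lemma abs_slope_sub_le {s R : Tile} (h : R.ω ⊆ s.ω) :
    |s.slope - R.slope| ≤ s.freqLen / 2 := by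
  have hR : R.slope ∈ R.ω := by
    have := R.freqLen_pos
    constructor <;> unfold slope <;> nlinarith
  obtain ⟨h₁, h₂⟩ := h hR
  rw [abs_le]
  unfold slope at *
  constructor <;> linarith

lemma len_le_of_subset {w : ℝ} (hw : 0 < w) {s R : Tile} (h : R.ω ⊆ s.ω) :
    s.len w ≤ R.len w := by
  have hR := R.freqLen_pos
  have hs := s.freqLen_pos
  obtain ⟨h₁, h₂⟩ := (Ico_subset_Ico_iff (by linarith)).1 h
  have h₃ : R.freqLen ≤ s.freqLen := by linarith
  have h₄ := len_mul_freqLen w s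
  have h₅ := len_mul_freqLen w R
  have h₆ := len_pos hw s
  refine le_of_mul_le_mul_right ?_ hR
  calc s.len w * R.freqLen ≤ s.len w * s.freqLen := by gcongr
    _ = R.len w * R.freqLen := by rw [h₄, h₅]

/-- When `ω_R ⊆ ω_s`, dilates of `s` have bounded height when measured along the slope
of `R`. -/
lemma abs_sub_le_of_mem_dilate {w C : ℝ} (hC : 0 < C) {s R : Tile}
    (h : R.ω ⊆ s.ω) {p : ℝ × ℝ} (hp : p ∈ s.dilate w C) :
    |p.1 - (s.center w).1| ≤ C * s.len w / 2 ∧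
      |(p.2 - R.slope * p.1) - ((s.center w).2 - R.slope * (s.center w).1)| ≤
        3 / 4 * C * w := by
  rw [dilate_eq_slantedBox w hC] at hp
  obtain ⟨⟨h₁, h₂⟩, h₃, h₄⟩ := hp
  set c := s.center w
  have hx : |p.1 - c.1| ≤ C * s.len w / 2 := by
    rw [abs_le]
    constructor <;> linarith
  have hy : |(p.2 - s.slope * p.1) - (c.2 - s.slope * c.1)| ≤ C * w / 2 := by
    rw [abs_le]
    constructor <;> linarith
  have hxs : |(s.slope - R.slope) * (p.1 - c.1)| ≤ C * w / 4 := by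
    have hs := s.freqLen_pos
    calc |(s.slope - R.slope) * (p.1 - c.1)|
        = |s.slope - R.slope| * |p.1 - c.1| := abs_mul _ _
      _ ≤ s.freqLen / 2 * (C * s.len w / 2) := by
        gcongr
        exact abs_slope_sub_le h
      _ = C * (s.len w * s.freqLen) / 4 := by ring
      _ = C * w / 4 := by rw [len_mul_freqLen]
  refine ⟨hx, ?_⟩
  rw [show (p.2 - R.slope * p.1) - (c.2 - R.slope * c.1) =
    ((p.2 - s.slope * p.1) - (c.2 - s.slope * c.1)) + (s.slope - R.slope) * (p.1 - c.1) by ring]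
  refine (abs_add_le _ _).trans ?_
  linarith

lemma dilate_subset_dilate_of_le {w C : ℝ} (hw : 0 < w) (hC : 1 ≤ C) {s R : Tile}
    (h : le w s R) : s.dilate w C ⊆ R.dilate w (12 * C) := by
  intro p hp
  have hc := h.1 (center_mem_rect hw s)
  obtain ⟨hx, hy⟩ := abs_sub_le_of_mem_dilate (by positivity) h.2 hp
  have hl := len_le_of_subset hw h.2
  have hR := len_pos hw R
  rw [dilate_eq_slantedBox w (by positivity)] at hc ⊢
  obtain ⟨⟨h₁, h₂⟩, h₃, h₄⟩ := hc
  rw [abs_le] at hx hy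
  obtain ⟨h₅, h₆⟩ := hx
  obtain ⟨h₇, h₈⟩ := hy
  have e₁ : C * s.len w ≤ C * R.len w := by gcongr
  have e₂ : R.len w ≤ C * R.len w := by nlinarith
  have e₃ : w ≤ C * w := by nlinarith
  refine ⟨⟨?_, ?_⟩, ?_, ?_⟩ <;> linarith

lemma rect_subset_slantedBox {w C : ℝ} (hw : 0 < w) (hC : 1 ≤ C) {s t R : Tile}
    (hs : R.ω ⊆ s.ω) (ht : R.ω ⊆ t.ω) (hst : (s.dilate w C ∩ t.dilate w C).Nonempty)
    (hlen : s.len w ≤ 2 * t.len w) :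
    s.rect w ⊆ slantedBox R.slope (t.center w) (3 * C * t.len w) (3 * C * w) := by
  intro p hp
  obtain ⟨q, hqs, hqt⟩ := hst
  have hp' : p ∈ s.dilate w 1 := by
    rw [dilate_eq_slantedBox w one_pos, one_mul, one_mul, ← rect_eq_slantedBox]
    exact hp
  have hC₀ : 0 < C := by positivity
  have b₁ := abs_sub_le_of_mem_dilate one_pos hs hp'
  have b₂ := abs_sub_le_of_mem_dilate hC₀ hs hqs
  have b₃ := abs_sub_le_of_mem_dilate hC₀ ht hqt
  simp only [abs_le] at b₁ b₂ b₃
  obtain ⟨⟨x₁, x₂⟩, y₁, y₂⟩ := b₁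
  obtain ⟨⟨x₃, x₄⟩, y₃, y₄⟩ := b₂
  obtain ⟨⟨x₅, x₆⟩, y₅, y₆⟩ := b₃
  have hl := len_pos hw t
  have e₁ : C * s.len w ≤ 2 * (C * t.len w) := by nlinarith
  have e₂ : t.len w ≤ C * t.len w := by nlinarith
  have e₃ : w ≤ C * w := by nlinarith
  refine ⟨⟨?_, ?_⟩, ?_, ?_⟩ <;> nlinarith

end Tile

/-- Vitali-type covering estimate for pairwise disjoint tiles below `R`: some subfamily has
pairwise disjoint `C`-dilates, whose total area controls that of the whole family. -/
lemma exists_disjoint_dilates {w C : ℝ} (hw : 0 < w) (hC : 1 ≤ C) (R : Tile) {ι : Type*}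
    (t : Finset ι) (s : ι → Tile) (hs : ∀ i ∈ t, R.ω ⊆ (s i).ω)
    (hd : ∀ i ∈ t, ∀ k ∈ t, i ≠ k → Disjoint ((s i).rect w) ((s k).rect w)) :
    ∃ u ⊆ t, (u : Set ι).PairwiseDisjoint (fun i => (s i).dilate w C) ∧
      ∑ i ∈ t, (s i).area w ≤ 36 * ∑ i ∈ u, volume.real ((s i).dilate w C) := by
  have hC₀ : 0 < C := by positivity
  obtain ⟨u, hut, hu, hcov⟩ := Vitali.exists_disjoint_subfamily_covering_enlargement
    (fun i => (s i).dilate w C) (t : Set ι) (fun i => (s i).len w) 2 one_lt_two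
    (fun i _ => (Tile.len_pos hw _).le) (R.len w)
    (fun i hi => Tile.len_le_of_subset hw (hs i hi))
    (fun i _ => ⟨_, mem_image_of_mem _ (Tile.center_mem_rect hw (s i))⟩)
  lift u to Finset ι using t.finite_toSet.subset hut
  have hut' : u ⊆ t := by exact_mod_cast hut
  refine ⟨u, hut', hu, ?_⟩
  set B : ι → Set (ℝ × ℝ) := fun k =>
    slantedBox R.slope ((s k).center w) (3 * C * (s k).len w) (3 * C * w)
  have hB : ∀ k, volume.real (B k) = 36 * volume.real ((s k).dilate w C) := by
    intro k
    have := Tile.len_pos hw (s k)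
    rw [Tile.measureReal_dilate hw hC₀, Tile.area_eq,
      measureReal_slantedBox _ _ (by positivity) (by positivity)]
    ring
  calc ∑ i ∈ t, (s i).area w
      = ∑ i ∈ t, volume.real ((s i).rect w) := by simp_rw [Tile.measureReal_rect hw]
    _ = volume.real (⋃ i ∈ t, (s i).rect w) := by
        refine (measureReal_biUnion_finset (fun i hi k hk => hd i hi k hk) ?_ ?_).symm
        · intro i _
          rw [Tile.rect_eq_slantedBox]
          exact measurableSet_slantedBox _ _ _ _
        · intro i _
          rw [Tile.rect_eq_slantedBox]
          exact volume_slantedBox_ne_top _ _ _ _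
    _ ≤ volume.real (⋃ k ∈ u, B k) := by
        refine measureReal_mono (iUnion₂_subset fun i hi => ?_) ?_
        · obtain ⟨k, hk, hik, hlen⟩ := hcov i hi
          exact (Tile.rect_subset_slantedBox hw hC (hs i hi) (hs k (hut' hk)) hik hlen).trans
            (subset_biUnion_of_mem (u := B) hk)
        · exact ((measure_biUnion_lt_top u.finite_toSet fun k _ =>
            (volume_slantedBox_ne_top _ _ _ _).lt_top)).ne
    _ ≤ ∑ k ∈ u, volume.real (B k) := measureReal_biUnion_finset_le _ _
    _ = 36 * ∑ i ∈ u, volume.real ((s i).dilate w C) := by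
        rw [Finset.mul_sum]
        exact Finset.sum_congr rfl fun k _ => hB k

/-- covering claim for tops with large `F`-intersection. -/
theorem covering_claim_for_tops
    : ∃ C c₁ : ℝ, 0 < C ∧ 0 < c₁ ∧
      ∀ (w : ℝ), 0 < w →
      ∀ (ε : ℝ), ε ∈ Ioo (0:ℝ) 1 →
      ∀ (σ : ℝ), σ ∈ Ioc (0:ℝ) 1 →
      ∀ (j : ℕ) (F : Set (ℝ × ℝ)), MeasurableSet F →
      ∀ (R : Tile) (𝒯 : Finset Tree),
        (∀ T ∈ 𝒯, T.IsTree w ∧ Tile.le w T.top R) →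
        (∀ T ∈ 𝒯, ∀ T' ∈ 𝒯, T ≠ T' → Disjoint (T.top.rect w) (T'.top.rect w)) →
        (∀ T ∈ 𝒯, σ ^ (1 + ε) * (volume (T.top.dilate w (σ ^ (-ε)))).toReal ≤
            (volume (T.top.dilate w (σ ^ (-ε)) ∩ F)).toReal) →
        (2:ℝ) ^ (-(j:ℤ)) * R.area w ≤ ∑ T ∈ 𝒯, T.top.area w →
        c₁ * σ ^ (1 + ε) * (2:ℝ) ^ (-(j:ℤ)) * R.area w ≤
          (volume (F ∩ R.dilate w (C * σ ^ (-ε)))).toReal := by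
  refine ⟨12, 1 / 36, by norm_num, by norm_num, ?_⟩
  intro w hw ε hε σ hσ j F hF R 𝒯 hle hd hmass harea
  set C := σ ^ (-ε)
  have hC : 1 ≤ C :=
    Real.one_le_rpow_of_pos_of_le_one_of_nonpos hσ.1 hσ.2 (by linarith [hε.1])
  have hC₀ : 0 < C := by positivity
  obtain ⟨u, hut, hu, hsum⟩ := exists_disjoint_dilates hw hC R 𝒯 Tree.top
    (fun T hT => (hle T hT).2.2) hd
  have hσ₀ : 0 < σ ^ (1 + ε) := Real.rpow_pos_of_pos hσ.1 _
  have hfin : ∀ (D : ℝ) (s : Tile), 0 < D → volume (s.dilate w D) ≠ ⊤ := fun D s hD => by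
    rw [Tile.dilate_eq_slantedBox w hD]
    exact volume_slantedBox_ne_top _ _ _ _
  calc 1 / 36 * σ ^ (1 + ε) * (2:ℝ) ^ (-(j:ℤ)) * R.area w
      = 1 / 36 * σ ^ (1 + ε) * ((2:ℝ) ^ (-(j:ℤ)) * R.area w) := by ring
    _ ≤ 1 / 36 * σ ^ (1 + ε) * (36 * ∑ T ∈ u, volume.real (T.top.dilate w C)) := by
        exact mul_le_mul_of_nonneg_left (harea.trans hsum) (by positivity)
    _ = ∑ T ∈ u, σ ^ (1 + ε) * volume.real (T.top.dilate w C) := by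
        rw [← Finset.mul_sum]
        ring
    _ ≤ ∑ T ∈ u, volume.real (T.top.dilate w C ∩ F) :=
        Finset.sum_le_sum fun T hT => hmass T (hut hT)
    _ = volume.real (⋃ T ∈ u, T.top.dilate w C ∩ F) := by
        refine (measureReal_biUnion_finset (fun T hT T' hT' hne =>
          (hu hT hT' hne).mono inter_subset_left inter_subset_left) ?_ ?_).symm
        · intro T _
          rw [Tile.dilate_eq_slantedBox w hC₀]
          exact (measurableSet_slantedBox _ _ _ _).inter hF
        · intro T _
          exact measure_ne_top_of_subset inter_subset_left (hfin C T.top hC₀)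
    _ ≤ volume.real (F ∩ R.dilate w (12 * C)) := by
        refine measureReal_mono (iUnion₂_subset fun T hT p hp => ⟨hp.2, ?_⟩) ?_
        · exact Tile.dilate_subset_dilate_of_le hw hC (hle T (hut hT)).2 hp.1
        · exact measure_ne_top_of_subset inter_subset_right (hfin _ R (by positivity))
end Bateman
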